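/- arXiv:2103.09064 — 5 statements merged into one kernel-verified Lean document; each statement's English description precedes it below -/
import Mathlib

section
/- Let q > 2 be a prime power. For any a ∈ 𝔽_q, the identity (a,∞) = μ ∘ ι ∘ τ_a holds as permutations of ℙ¹(𝔽_q), where μ is the permutation induced by the degree-one rational function x ↦ x⁻¹ + a (i.e. μ = σ_a ∘ Inv where σ_a is the translation x ↦ x + a). -/
/-- In a finite field of `q > 2` elements, `x ^ (q - 2)` is the inverse of a nonzero `x`. -/
theorem pow_card_sub_two_eq_inv {F : Type*} [Field F] [Fintype F]
    (hq : 2 < Fintype.card F) {x : F} (hx : x ≠ 0) :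
    x ^ (Fintype.card F - 2) = x⁻¹ := by
  refine eq_inv_of_mul_eq_one_left ?_
  rw [← pow_succ, show Fintype.card F - 2 + 1 = Fintype.card F - 1 by omega]
  exact FiniteField.pow_card_sub_one_eq_one x hx

/-- For a ∈ 𝔽_q, (a,∞) = μ ∘ ι ∘ τ_a as permutations of ℙ¹(𝔽_q)
(modeled as `Option F` with `none` as ∞), where μ = σ_a ∘ Inv is induced by x ↦ x⁻¹ + a. -/
theorem swap_infty_eq_mobius_comp
    {F : Type*} [Field F] [Fintype F] [DecidableEq F]
    (hq : 2 < Fintype.card F)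
    (ι : Equiv.Perm (Option F))
    (hι_infty : ι none = none)
    (hι : ∀ a : F, ι (some a) = some (a ^ (Fintype.card F - 2)))
    (Inv : Equiv.Perm (Option F))
    (hInv_infty : Inv none = some 0)
    (hInv_zero : Inv (some 0) = none)
    (hInv : ∀ a : F, a ≠ 0 → Inv (some a) = some a⁻¹)
    (a : F) :
    Equiv.swap (some a) none
      = ((Equiv.addRight a).optionCongr * Inv) * ι * (Equiv.subRight a).optionCongr := by
  ext1 x
  rcases x with _ | x
  · simp [hι_infty, hInv_infty]
  by_cases hx : x = a
  · have h : Fintype.card F - 2 ≠ 0 := by omega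
    simp [hx, hι, hInv_zero, zero_pow h]
  · have hxa : x - a ≠ 0 := sub_ne_zero.mpr hx
    rw [Equiv.swap_apply_of_ne_of_ne (by simpa using hx) (by simp)]
    simp [hι, pow_card_sub_two_eq_inv hq hxa, hInv _ (inv_ne_zero hxa)]
end

section
/- Let q > 2 be a prime power, k a positive integer, and σ a permutation of ℙ¹(𝔽_q). Let 𝒜_{σ,k} be the set of pairs (μ, (a₁,…,a_k)) with μ a permutation of ℙ¹(𝔽_q) induced by a degree-one rational function and a₁,…,a_k ∈ 𝔽_q such that σ = μ ∘ ι ∘ τ_{a_k} ∘ ι ∘ τ_{a_{k−1}} ∘ ⋯ ∘ ι ∘ τ_{a₁}, and let 𝒞_{σ,k} be the set of pairs (ν, (b₁,…,b_k)) with ν a permutation of ℙ¹(𝔽_q) induced by a degree-one rational function and b₁,…,b_k ∈ 𝔽_q such that σ = ν ∘ (b₁,∞) ∘ (b₂,∞) ∘ ⋯ ∘ (b_k,∞). Then the map sending (μ, (a₁,…,a_k)) to (μ ∘ Inv ∘ τ_{a_k} ∘ Inv ∘ τ_{a_{k−1}} ∘ ⋯ ∘ Inv ∘ τ_{a₁},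 F(a₁,…,a_k)) is a bijection from 𝒜_{σ,k} onto 𝒞_{σ,k}; in particular the finite sets 𝒜_{σ,k} and 𝒞_{σ,k} have the same cardinality. -/
/-- The action of the degree-one rational function (αx+β)/(γx+δ) on ℙ¹(𝔽_q),
modeled as `Option F` with `none` as ∞. -/
def mobiusFun {F : Type*} [Field F] [DecidableEq F] (α β γ δ : F) : Option F → Option F
  | none => if γ = 0 then none else some (α / γ)
  | some x => if γ * x + δ = 0 then none else some ((α * x + β) / (γ * x + δ))

/-- A permutation of ℙ¹(𝔽_q) is induced by a degree-one rational function if it acts as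
some (αx+β)/(γx+δ) with αδ − βγ ≠ 0. -/
def IsMobius {F : Type*} [Field F] [DecidableEq F] (m : Equiv.Perm (Option F)) : Prop :=
  ∃ α β γ δ : F, α * δ - β * γ ≠ 0 ∧ ∀ x, m x = mobiusFun α β γ δ x

/-- The sequence `c_{i,j}` from the paper: `c_{i,0} = 0` and
`c_{i,j} = c_{i,j-1}^{q-2} + a_{i-j+1}` (indices of `a` are 0-based here). -/
def cRec {F : Type*} [Field F] (q : ℕ) {k : ℕ} (a : Fin k → F) (i : Fin k) : ℕ → F
  | 0 => 0
  | j + 1 => (cRec q a i j) ^ (q - 2)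
      + a ⟨i.val - j, lt_of_le_of_lt (Nat.sub_le _ _) i.isLt⟩

/-- The map F : 𝔽_q^k → 𝔽_q^k, sending (a₁,…,a_k) to (c_{1,1},…,c_{k,k}). -/
def Fvec {F : Type*} [Field F] (q : ℕ) {k : ℕ} (a : Fin k → F) : Fin k → F :=
  fun i => cRec q a i (i.val + 1)

section Mobius

variable {F : Type*} [Field F] [DecidableEq F]

theorem mobiusFun_mobiusFun (α β γ δ : F) {α' β' γ' δ' : F}
    (h' : α' * δ' - β' * γ' ≠ 0) (x : Option F) :
    mobiusFun α β γ δ (mobiusFun α' β' γ' δ' x) =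
      mobiusFun (α * α' + β * γ') (α * β' + β * δ') (γ * α' + δ * γ') (γ * β' + δ * δ') x := by
  have key : ∀ u v : F, (v = 0 → u ≠ 0) →
      mobiusFun α β γ δ (if v = 0 then none else some (u / v)) =
        if γ * u + δ * v = 0 then none else some ((α * u + β * v) / (γ * u + δ * v)) := by
    intro u v huv
    by_cases hv : v = 0
    · subst hv
      have hu := huv rfl
      by_cases hγ : γ = 0
      · simp [mobiusFun, hγ]
      · simp [mobiusFun, hγ, hu, mul_div_mul_right]
    · have e : γ * (u / v) + δ = (γ * u + δ * v) / v := by field_simp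
      have e' : α * (u / v) + β = (α * u + β * v) / v := by field_simp
      simp only [mobiusFun, hv, if_false, e, e', div_eq_zero_iff, or_false]
      split_ifs <;> simp [div_div_div_cancel_right₀ hv]
  cases x with
  | none =>
    have := key α' γ' (by rintro rfl rfl; simp at h')
    simpa [mobiusFun] using this
  | some x =>
    have := key (α' * x + β') (γ' * x + δ') (by
      intro h1 h2
      by_cases hγ : γ' = 0
      · subst hγ
        have : δ' = 0 := by simpa using h1
        subst this
        simp at h'
      · exact h' (mul_left_cancel₀ hγ (by linear_combination (γ' * α') * h1 - γ' * γ' * h2)))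
    simp only [mobiusFun] at this ⊢
    rw [this]
    ring_nf

theorem IsMobius.mul {m n : Equiv.Perm (Option F)} (hm : IsMobius m) (hn : IsMobius n) :
    IsMobius (m * n) := by
  obtain ⟨α, β, γ, δ, h, hm⟩ := hm
  obtain ⟨α', β', γ', δ', h', hn⟩ := hn
  refine ⟨α * α' + β * γ', α * β' + β * δ', γ * α' + δ * γ', γ * β' + δ * δ', ?_, fun x => ?_⟩
  · convert mul_ne_zero h h' using 1
    ring
  · rw [Equiv.Perm.mul_apply, hn, hm, mobiusFun_mobiusFun _ _ _ _ h']

theorem isMobius_one : IsMobius (1 : Equiv.Perm (Option F)) :=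
  ⟨1, 0, 0, 1, by simp, fun x => by cases x <;> simp [mobiusFun]⟩

theorem IsMobius.inv [Finite F] {m : Equiv.Perm (Option F)} (hm : IsMobius m) :
    IsMobius m⁻¹ := by
  let S : Submonoid (Equiv.Perm (Option F)) :=
    { carrier := {m | IsMobius m}, mul_mem' := IsMobius.mul, one_mem' := isMobius_one }
  have : m⁻¹ = m ^ (orderOf m - 1) := by
    rw [inv_eq_iff_mul_eq_one, ← pow_succ', Nat.sub_add_cancel (orderOf_pos m), pow_orderOf_eq_one]
  rw [this]
  exact S.pow_mem (x := m) hm _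

theorem isMobius_subRight (a : F) : IsMobius (Equiv.subRight a).optionCongr :=
  ⟨1, -a, 0, 1, by simp, fun x => by cases x <;> simp [mobiusFun, sub_eq_add_neg]⟩

end Mobius

section TranslationProducts

variable {F : Type*} [Field F]

/-- The permutation `g ∘ τ_{a_k} ∘ ⋯ ∘ g ∘ τ_{a₁}`. -/
def translationProd (g : Equiv.Perm (Option F)) {k : ℕ} (a : Fin k → F) :
    Equiv.Perm (Option F) :=
  (List.ofFn (fun i : Fin k => g * (Equiv.subRight (a i.rev)).optionCongr)).prod

@[simp]
theorem translationProd_zero (g : Equiv.Perm (Option F)) (a : Fin 0 → F) :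
    translationProd g a = 1 := by
  simp [translationProd]

theorem translationProd_succ (g : Equiv.Perm (Option F)) {k : ℕ} (a : Fin (k + 1) → F) :
    translationProd g a =
      g * (Equiv.subRight (a (Fin.last k))).optionCongr * translationProd g (Fin.init a) := by
  simp [translationProd, List.ofFn_succ, Fin.rev_succ, Fin.init]

theorem isMobius_translationProd [DecidableEq F] {g : Equiv.Perm (Option F)} (hg : IsMobius g)
    {k : ℕ} (a : Fin k → F) : IsMobius (translationProd g a) := by
  induction k with
  | zero => simpa using isMobius_one
  | succ k ih =>
    rw [translationProd_succ]
    exact (hg.mul (isMobius_subRight _)).mul (ih _)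

theorem translationProd_none {g : Equiv.Perm (Option F)} (hg : g none = none)
    {k : ℕ} (a : Fin k → F) : translationProd g a none = none := by
  induction k with
  | zero => simp
  | succ k ih => simp [translationProd_succ, ih, hg]

theorem cRec_castSucc (q : ℕ) {k : ℕ} (a : Fin (k + 1) → F) (i : Fin k) (j : ℕ) :
    cRec q a i.castSucc j = cRec q (Fin.init a) i j := by
  induction j with
  | zero => rfl
  | succ j ih => simp [cRec, ih, Fin.init]

theorem Fvec_castSucc (q : ℕ) {k : ℕ} (a : Fin (k + 1) → F) (i : Fin k) :
    Fvec q a i.castSucc = Fvec q (Fin.init a) i :=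
  cRec_castSucc q a i _

variable {q : ℕ} {ι : Equiv.Perm (Option F)}

/-- Applying the first `n` factors to `c_{i,i}` undoes the last `n` steps of its recursion. -/
theorem translationProd_Fvec_apply (hι : ∀ a : F, ι (some a) = some (a ^ (q - 2)))
    (hι_invol : ∀ a : F, (a ^ (q - 2)) ^ (q - 2) = a)
    {k : ℕ} (a : Fin k → F) (i : Fin k) (n : ℕ) (hn : n ≤ i) :
    translationProd ι (fun m : Fin n => a ⟨m, by omega⟩) (some (Fvec q a i)) =
      some (cRec q a i (i + 1 - n)) := by
  induction n with
  | zero => simp [Fvec]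
  | succ n ih =>
    rw [translationProd_succ, Equiv.Perm.mul_apply]
    have := ih (by omega)
    simp only [Fin.init_def, Fin.val_castSucc, Fin.val_last] at this ⊢
    rw [this, show (i : ℕ) + 1 - n = (i - n) + 1 by omega,
      show (i : ℕ) + 1 - (n + 1) = i - n by omega]
    simp [cRec, hι, hι_invol, show (i : ℕ) - (i - n) = n by omega]

theorem translationProd_init_Fvec_last (hq : 2 < q)
    (hι : ∀ a : F, ι (some a) = some (a ^ (q - 2)))
    (hι_invol : ∀ a : F, (a ^ (q - 2)) ^ (q - 2) = a) {k : ℕ} (a : Fin (k + 1) → F) :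
    translationProd ι (Fin.init a) (some (Fvec q a (Fin.last k))) = some (a (Fin.last k)) := by
  have := translationProd_Fvec_apply hι hι_invol a (Fin.last k) k le_rfl
  simp only [Fin.val_last, Nat.add_sub_cancel_left] at this
  rw [show Fin.init a = fun m : Fin k => a ⟨m, by omega⟩ from rfl, this]
  simp [cRec, zero_pow (show q - 2 ≠ 0 by omega)]
  rfl

theorem Fvec_injective (hq : 2 < q) (hι : ∀ a : F, ι (some a) = some (a ^ (q - 2)))
    (hι_invol : ∀ a : F, (a ^ (q - 2)) ^ (q - 2) = a) (k : ℕ) :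
    Function.Injective (Fvec q : (Fin k → F) → Fin k → F) := by
  induction k with
  | zero => exact Function.injective_of_subsingleton _
  | succ k ih =>
    intro a b hab
    have hinit : Fin.init a = Fin.init b := ih (funext fun i => by
      simpa only [Fvec_castSucc] using congrFun hab i.castSucc)
    have hlast : a (Fin.last k) = b (Fin.last k) := by
      rw [← Option.some_inj, ← translationProd_init_Fvec_last hq hι hι_invol a,
        ← translationProd_init_Fvec_last hq hι hι_invol b, hinit, hab]
    rw [← Fin.snoc_init_self a, ← Fin.snoc_init_self b, hinit, hlast]

/-- Moving all the transpositions in `ι = Inv ∘ (0,∞)` to the right. -/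
theorem translationProd_eq_mul_swaps [DecidableEq F] (hq : 2 < q) (hι_infty : ι none = none)
    (hι : ∀ a : F, ι (some a) = some (a ^ (q - 2)))
    (hι_invol : ∀ a : F, (a ^ (q - 2)) ^ (q - 2) = a) {Inv : Equiv.Perm (Option F)}
    (hInv : ι = Inv * Equiv.swap (some 0) none) {k : ℕ} (a : Fin k → F) :
    translationProd ι a = translationProd Inv a *
      (List.ofFn (fun i : Fin k => Equiv.swap (some (Fvec q a i)) none)).prod := by
  induction k with
  | zero => simp
  | succ k ih =>
    rw [List.ofFn_succ', List.concat_eq_append, List.prod_append, List.prod_singleton]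
    simp only [Fvec_castSucc]
    rw [translationProd_succ Inv, mul_assoc _ (translationProd Inv _),
      ← mul_assoc (translationProd Inv _), ← ih, translationProd_succ ι]
    have h1 : ι * (Equiv.subRight (a (Fin.last k))).optionCongr =
        Inv * (Equiv.subRight (a (Fin.last k))).optionCongr *
          Equiv.swap (some (a (Fin.last k))) none := by
      rw [hInv, mul_assoc, mul_assoc, Equiv.mul_swap_eq_swap_mul]
      simp
    rw [h1, mul_assoc, Equiv.mul_swap_eq_swap_mul (translationProd ι _),
      translationProd_init_Fvec_last hq hι hι_invol, translationProd_none hι_infty]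

end TranslationProducts

/-- the natural map from the set 𝒜_{σ,k} of algebraic representations
σ = μ ∘ ι ∘ τ_{a_k} ∘ ⋯ ∘ ι ∘ τ_{a₁} to the set 𝒞_{σ,k} of combinatorial representations
σ = ν ∘ (b₁,∞) ∘ ⋯ ∘ (b_k,∞), sending (μ, a) to
(μ ∘ Inv ∘ τ_{a_k} ∘ ⋯ ∘ Inv ∘ τ_{a₁}, F(a)), is a bijection from 𝒜_{σ,k} onto 𝒞_{σ,k};
in particular the two finite sets have the same cardinality. -/
theorem alg_comb_bijection
    {F : Type*} [Field F] [Fintype F] [DecidableEq F]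
    (hq : 2 < Fintype.card F) (k : ℕ) (hk : 0 < k)
    (ι : Equiv.Perm (Option F))
    (hι_infty : ι none = none)
    (hι : ∀ a : F, ι (some a) = some (a ^ (Fintype.card F - 2)))
    (Inv : Equiv.Perm (Option F))
    (hInv_infty : Inv none = some 0)
    (hInv_zero : Inv (some 0) = none)
    (hInv : ∀ a : F, a ≠ 0 → Inv (some a) = some a⁻¹)
    (σ : Equiv.Perm (Option F)) :
    Set.BijOn
      (fun p : Equiv.Perm (Option F) × (Fin k → F) =>
        (p.1 * (List.ofFn (fun i : Fin k =>
            Inv * (Equiv.subRight (p.2 i.rev)).optionCongr)).prod,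
          Fvec (Fintype.card F) p.2))
      {p : Equiv.Perm (Option F) × (Fin k → F) | IsMobius p.1 ∧
        σ = p.1 * (List.ofFn (fun i : Fin k =>
              ι * (Equiv.subRight (p.2 i.rev)).optionCongr)).prod}
      {p : Equiv.Perm (Option F) × (Fin k → F) | IsMobius p.1 ∧
        σ = p.1 * (List.ofFn (fun i : Fin k => Equiv.swap (some (p.2 i)) none)).prod}
    ∧
    Set.ncard {p : Equiv.Perm (Option F) × (Fin k → F) | IsMobius p.1 ∧
        σ = p.1 * (List.ofFn (fun i : Fin k =>
              ι * (Equiv.subRight (p.2 i.rev)).optionCongr)).prod}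
      = Set.ncard {p : Equiv.Perm (Option F) × (Fin k → F) | IsMobius p.1 ∧
        σ = p.1 * (List.ofFn (fun i : Fin k => Equiv.swap (some (p.2 i)) none)).prod} := by
  have hpow : ∀ a : F, a ≠ 0 → a ^ (Fintype.card F - 2) = a⁻¹ := fun a ha => by
    apply eq_inv_of_mul_eq_one_left
    rw [← pow_succ, show Fintype.card F - 2 + 1 = Fintype.card F - 1 by omega,
      FiniteField.pow_card_sub_one_eq_one a ha]
  have hι_invol : ∀ a : F, (a ^ (Fintype.card F - 2)) ^ (Fintype.card F - 2) = a := by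
    intro a
    rcases eq_or_ne a 0 with rfl | ha
    · simp [zero_pow (show Fintype.card F - 2 ≠ 0 by omega)]
    · rw [hpow a ha, hpow _ (inv_ne_zero ha), inv_inv]
  have hιInv : ι = Inv * Equiv.swap (some 0) none := by
    ext1 x
    rw [Equiv.Perm.mul_apply]
    rcases x with _ | a
    · rw [hι_infty, Equiv.swap_apply_right, hInv_zero]
    · rcases eq_or_ne a 0 with rfl | ha
      · rw [Equiv.swap_apply_left, hInv_infty, hι,
          zero_pow (show Fintype.card F - 2 ≠ 0 by omega)]
      · rw [Equiv.swap_apply_of_ne_of_ne (by simpa using ha) (by simp), hInv a ha, hι, hpow a ha]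
  have hInvMobius : IsMobius Inv := by
    refine ⟨0, 1, 1, 0, by simp, fun x => ?_⟩
    rcases x with _ | a
    · simp [mobiusFun, hInv_infty]
    · rcases eq_or_ne a 0 with rfl | ha
      · simp [mobiusFun, hInv_zero]
      · simp [mobiusFun, hInv a ha, ha]
  have hprod := fun a : Fin k → F =>
    translationProd_eq_mul_swaps hq hι_infty hι hι_invol hιInv a
  have hinj := Fvec_injective hq hι hι_invol k
  refine (fun hbij => ⟨hbij, ?_⟩) ⟨?_, ?_, ?_⟩
  · rw [← hbij.image_eq, hbij.injOn.ncard_image]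
  · rintro ⟨μ, a⟩ ⟨hμ, hσ⟩
    refine ⟨hμ.mul (isMobius_translationProd hInvMobius a), ?_⟩
    change σ = μ * translationProd ι a at hσ
    rw [hσ, hprod, ← mul_assoc]
    rfl
  · rintro ⟨μ, a⟩ - ⟨μ', a'⟩ - h
    obtain ⟨h1, h2⟩ := Prod.mk.inj h
    obtain rfl := hinj h2
    exact Prod.ext (mul_right_cancel h1) rfl
  · rintro ⟨ν, b⟩ ⟨hν, hσ⟩
    obtain ⟨a, rfl⟩ := Finite.surjective_of_injective hinj b
    refine ⟨(ν * (translationProd Inv a)⁻¹, a),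
      ⟨hν.mul (isMobius_translationProd hInvMobius a).inv, ?_⟩,
      Prod.ext (inv_mul_cancel_right ν (translationProd Inv a)) rfl⟩
    change σ = ν * (translationProd Inv a)⁻¹ * translationProd ι a
    rw [hσ, hprod, mul_assoc ν, inv_mul_cancel_left]
end

section
/- Let q > 2 be a prime power. Every permutation of 𝔽_q is a composition of the map ρ : a ↦ a^{q−2} and permutations induced by degree-one polynomials over 𝔽_q; equivalently, the symmetric group on 𝔽_q is generated by ρ together with the permutations x ↦ αx + β (α, β ∈ 𝔽_q, α ≠ 0). -/
/-- A permutation of 𝔽_q is induced by a degree-one polynomial if it acts as x ↦ αx + β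
for some α ≠ 0. -/
def IsAffinePerm {F : Type*} [Field F] (π : Equiv.Perm F) : Prop :=
  ∃ α β : F, α ≠ 0 ∧ ∀ x, π x = α * x + β

/-- The affine permutation `x ↦ α * x + β`, for `α ≠ 0`. -/
def affinePerm {F : Type*} [Field F] (α β : F) (hα : α ≠ 0) : Equiv.Perm F :=
  (Equiv.mulLeft₀ α hα).trans (Equiv.addRight β)

@[simp]
theorem affinePerm_apply {F : Type*} [Field F] (α β : F) (hα : α ≠ 0) (x : F) :
    affinePerm α β hα x = α * x + β := rfl

theorem isAffinePerm_affinePerm {F : Type*} [Field F] (α β : F) (hα : α ≠ 0) :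
    IsAffinePerm (affinePerm α β hα) :=
  ⟨α, β, hα, fun _ => rfl⟩

theorem FiniteField.pow_card_sub_two {F : Type*} [Field F] [Fintype F]
    (hq : 2 < Fintype.card F) (a : F) : a ^ (Fintype.card F - 2) = a⁻¹ := by
  rcases eq_or_ne a 0 with rfl | ha
  · rw [zero_pow (by omega), inv_zero]
  · apply eq_inv_of_mul_eq_one_left
    rw [← pow_succ, show Fintype.card F - 2 + 1 = Fintype.card F - 1 by omega,
      FiniteField.pow_card_sub_one_eq_one a ha]

/-- The map `x ↦ 1 - x⁻¹` has order three as a Möbius transformation; with the convention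
`0⁻¹ = 0`, its cube exchanges `0` and `1` instead. -/
theorem affinePerm_mul_inv_pow_three {F : Type*} [Field F] [DecidableEq F]
    (ρ : Equiv.Perm F) (hρ : ∀ a, ρ a = a⁻¹) :
    (affinePerm (-1) 1 (neg_ne_zero.2 one_ne_zero) * ρ) ^ 3 = Equiv.swap (0 : F) 1 := by
  ext x
  simp only [pow_succ, pow_zero, one_mul, Equiv.Perm.mul_apply, affinePerm_apply, hρ]
  rcases eq_or_ne x 0 with rfl | h0
  · simp
  rcases eq_or_ne x 1 with rfl | h1
  · simp
  have h2 : x - 1 ≠ 0 := sub_ne_zero.2 h1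
  rw [Equiv.swap_apply_of_ne_of_ne h0 h1,
    show -1 * x⁻¹ + 1 = (x - 1) / x by field_simp; ring, inv_div,
    show -1 * (x / (x - 1)) + 1 = -(x - 1)⁻¹ by field_simp; ring, inv_neg, inv_inv]
  ring

/-- Carlitz's theorem: for q > 2, the symmetric group on 𝔽_q is generated
by the permutation ρ : a ↦ a^{q−2} together with the permutations induced by degree-one
polynomials x ↦ αx + β (α ≠ 0). -/
theorem carlitz_generators
    {F : Type*} [Field F] [Fintype F]
    (hq : 2 < Fintype.card F)
    (ρ : Equiv.Perm F) (hρ : ∀ a : F, ρ a = a ^ (Fintype.card F - 2)) :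
    Subgroup.closure (insert ρ {π : Equiv.Perm F | IsAffinePerm π}) = ⊤ := by
  classical
  set H := Subgroup.closure (insert ρ {π : Equiv.Perm F | IsAffinePerm π})
  have hA (α β : F) (hα : α ≠ 0) : affinePerm α β hα ∈ H :=
    Subgroup.subset_closure (Or.inr (isAffinePerm_affinePerm α β hα))
  have hswap : Equiv.swap (0 : F) 1 ∈ H := by
    rw [← affinePerm_mul_inv_pow_three ρ fun a =>
      (hρ a).trans (FiniteField.pow_card_sub_two hq a)]
    exact pow_mem (mul_mem (hA _ _ _) (Subgroup.subset_closure (Or.inl rfl))) 3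
  rw [eq_top_iff, ← Equiv.Perm.closure_isSwap, Subgroup.closure_le]
  rintro _ ⟨a, b, hab, rfl⟩
  have hα : b - a ≠ 0 := sub_ne_zero.2 hab.symm
  have hconj := Equiv.swap_apply_apply (affinePerm (b - a) a hα) 0 1
  simp only [affinePerm_apply, mul_zero, zero_add, mul_one, sub_add_cancel] at hconj
  rw [hconj]
  exact mul_mem (mul_mem (hA _ _ _) hswap) (inv_mem (hA _ _ _))
end

section
/- Let q > 2 be a prime power and let f = μ ∘ σ be a permutation of 𝔽_q (extended to ℙ¹(𝔽_q) fixing ∞), where μ is a permutation of ℙ¹(𝔽_q) induced by a degree-one rational function and σ is a permutation of ℙ¹(𝔽_q) which moves exactly s points of 𝔽_q and has exactly t nontrivial orbits on ℙ¹(𝔽_q). Define n := s + t if σ(∞) = ∞ and n := s + t − 1 if σ(∞) ≠ ∞. Then the Carlitz rank of f is at most n. -/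
/-- `f` admits a representation `f = θ₀ ∘ ρ ∘ θ₁ ∘ ρ ∘ ⋯ ∘ ρ ∘ θ_n` with each θᵢ induced
by a degree-one polynomial.  The Carlitz rank of `f` is the least such `n`. -/
def HasCRRep {F : Type*} [Field F] (ρ f : Equiv.Perm F) (n : ℕ) : Prop :=
  ∃ θ : Fin (n + 1) → Equiv.Perm F, (∀ i, IsAffinePerm (θ i)) ∧
    f = θ 0 * (List.ofFn (fun i : Fin n => ρ * θ i.succ)).prod

open Equiv Equiv.Perm

theorem exists_map_some_of_none_notMem {α : Type*} (l : List (Option α)) (hl : none ∉ l) :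
    ∃ l' : List α, l = l'.map some := by
  induction l with
  | nil => exact ⟨[], rfl⟩
  | cons a l ih =>
    rw [List.mem_cons, not_or] at hl
    obtain ⟨l', rfl⟩ := ih hl.2
    obtain ⟨b, rfl⟩ := Option.ne_none_iff_exists'.1 (Ne.symm hl.1)
    exact ⟨b :: l', rfl⟩

/-- The product `(∞ a₁) ∘ ⋯ ∘ (∞ aₖ)` of the transpositions of `∞` with the entries of a list. -/
def starProd {α : Type*} [DecidableEq α] (l : List α) : Equiv.Perm (Option α) :=
  (l.map fun a => swap none (some a)).prod

section StarProd

variable {α : Type*} [DecidableEq α]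

theorem starProd_nil : starProd ([] : List α) = 1 := rfl

theorem starProd_cons (a : α) (l : List α) :
    starProd (a :: l) = swap none (some a) * starProd l := by
  simp [starProd]

theorem starProd_append (l l' : List α) :
    starProd (l ++ l') = starProd l * starProd l' := by
  simp [starProd]

/-- A cycle through `∞` is a star product with one factor per finite point of the cycle. -/
theorem formPerm_none_cons (l : List α) (hl : l.Nodup) :
    (none :: l.map some).formPerm = starProd l.reverse := by
  induction l using List.reverseRecOn with
  | nil => simp [starProd_nil]
  | append_singleton l a ih =>
    have hnd : (none :: (l ++ [a]).map some).Nodup := by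
      rw [List.nodup_cons]
      exact ⟨by simp, hl.map (Option.some_injective α)⟩
    have hrot : (none :: (l ++ [a]).map some) ~r (some a :: none :: l.map some) := by
      have := @List.isRotated_append _ (none :: l.map some) [some a]
      simpa using this
    rw [List.formPerm_eq_of_isRotated hnd hrot, List.formPerm_cons_cons,
      ih (List.nodup_append.1 hl).1, List.reverse_append, List.reverse_singleton,
      List.singleton_append, starProd_cons, swap_comm]

/-- Every permutation of `Option α` is a star product whose length is given by the size of its
support, the number of its cycles, and whether it moves `∞`. -/
theorem exists_starProd [Fintype α] (σ : Equiv.Perm (Option α)) :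
    ∃ l : List α, σ = starProd l ∧
      l.length + (if σ none = none then 0 else 2) =
        σ.support.card + σ.cycleFactorsFinset.card := by
  induction σ using Equiv.Perm.cycle_induction_on with
  | base_one => exact ⟨[], by simp [starProd_nil]⟩
  | base_cycles c hc =>
    have hlist : ∀ x, c x ≠ x → ∃ m : List (Option α), (x :: m).Nodup ∧
        c = (x :: m).formPerm ∧ (x :: m).length = c.support.card ∧
        ∀ y ∈ x :: m, c y ≠ y := by
      intro x hx
      have hmem : x ∈ c.support := mem_support.2 hx
      have h0 := toList_getElem_zero (p := c) (x := x) hmem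
      have hnd := nodup_toList c x
      have hf := formPerm_toList c x
      have hlen := length_toList c x
      have hm : ∀ y ∈ toList c x, c y ≠ y := fun y hy =>
        mem_support.1 (((mem_toList_iff.1 hy).1.mem_support_iff).1 hmem)
      rw [hc.cycleOf_eq hx] at hf hlen
      cases h : toList c x with
      | nil => exact absurd hmem (toList_eq_nil_iff.1 h)
      | cons z m =>
        have hz : z = x := by simpa [h] using h0
        subst hz
        rw [h] at hnd hf hlen hm
        exact ⟨m, hnd, hf.symm, hlen, hm⟩
    rw [hc.cycleFactorsFinset_eq_singleton, Finset.card_singleton]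
    by_cases hn : c none = none
    · obtain ⟨x, hx, -⟩ := hc
      obtain ⟨m, hnd, hf, hlen, hm⟩ := hlist x hx
      obtain ⟨l, hl⟩ := exists_map_some_of_none_notMem (x :: m) fun h => hm _ h hn
      rw [hl] at hnd hf hlen
      cases l with
      | nil => simp at hl
      | cons a l =>
        refine ⟨a :: (a :: l).reverse, ?_, ?_⟩
        · rw [starProd_cons, ← formPerm_none_cons _ hnd.of_map, List.map_cons,
            List.formPerm_cons_cons, swap_mul_self_mul, hf, List.map_cons]
        · rw [if_pos hn, ← hlen]
          simp
    · obtain ⟨m, hnd, hf, hlen, hm⟩ := hlist none hn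
      obtain ⟨l, rfl⟩ := exists_map_some_of_none_notMem m (List.nodup_cons.1 hnd).1
      refine ⟨l.reverse, ?_, ?_⟩
      · rw [hf, formPerm_none_cons _ (List.nodup_cons.1 hnd).2.of_map]
      · rw [if_neg hn, ← hlen]
        simp
  | induction_disjoint c τ hd _ ihc ihτ =>
    obtain ⟨l, hl, hlen⟩ := ihc
    obtain ⟨l', hl', hlen'⟩ := ihτ
    refine ⟨l ++ l', by rw [starProd_append, ← hl, ← hl'], ?_⟩
    rw [hd.card_support_mul, hd.cycleFactorsFinset_mul_eq_union,
      Finset.card_union_of_disjoint hd.disjoint_cycleFactorsFinset, List.length_append]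
    have hfix : (c * τ) none = none ↔ c none = none ∧ τ none = none :=
      hd.mul_apply_eq_iff
    rcases hd none with h | h <;> simp only [hfix, h, if_true, true_and, and_true] at * <;> omega

end StarProd

theorem card_support_option {α : Type*} [Fintype α] [DecidableEq α]
    (σ : Equiv.Perm (Option α)) :
    σ.support.card = (Finset.filter (fun x : α => σ (some x) ≠ some x) Finset.univ).card +
      (if σ none = none then 0 else 1) := by
  have h : σ.support = (if σ none = none then ∅ else {none}) ∪
      (Finset.filter (fun x : α => σ (some x) ≠ some x) Finset.univ).map
        Function.Embedding.some := by
    ext x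
    cases x <;> by_cases h : σ none = none <;> simp [h]
  rw [h, Finset.card_union_of_disjoint, Finset.card_map, add_comm]
  · split_ifs <;> simp
  · split_ifs <;> simp

theorem card_cycleFactorsFinset_le {β : Type*} [Fintype β] [DecidableEq β]
    (σ : Equiv.Perm β) :
    σ.cycleFactorsFinset.card ≤ Set.ncard {o : Set β | ∃ x, σ x ≠ x ∧
      o = Set.range (fun m : ℤ => (σ ^ m) x)} := by
  rw [← Set.ncard_coe_finset]
  refine Set.ncard_le_ncard_of_injOn (fun c => (c.support : Set β)) ?_ ?_ (Set.toFinite _)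
  · intro c hc
    obtain ⟨x, hx⟩ := (mem_cycleFactorsFinset_iff.1 hc).1.nonempty_support
    have hσx : x ∈ σ.support := mem_cycleFactorsFinset_support_le hc hx
    refine ⟨x, mem_support.1 hσx, ?_⟩
    ext y
    rw [cycle_is_cycleOf hx hc, Finset.mem_coe, mem_support_cycleOf_iff, Set.mem_range]
    exact ⟨fun h => h.1, fun h => ⟨h, hσx⟩⟩
  · intro c hc d hd hcd
    obtain ⟨x, hx⟩ := (mem_cycleFactorsFinset_iff.1 hc).1.nonempty_support
    have hxd : x ∈ d.support := by
      rw [← Finset.coe_inj.1 hcd]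
      exact hx
    rw [cycle_is_cycleOf hx hc, cycle_is_cycleOf hxd hd]

section CarlitzRank

variable {F : Type*} [Field F]

theorem HasCRRep.cons {ρ f θ : Equiv.Perm F} {n : ℕ} (hθ : IsAffinePerm θ)
    (hf : HasCRRep ρ f n) : HasCRRep ρ (θ * ρ * f) (n + 1) := by
  obtain ⟨θs, hθs, rfl⟩ := hf
  refine ⟨Fin.cons θ θs, Fin.cases hθ hθs, ?_⟩
  simp [List.ofFn_succ, mul_assoc]

variable [DecidableEq F]

theorem hasCRRep_zero_of_isMobius {ρ f : Equiv.Perm F} (hf : IsMobius f.optionCongr) :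
    HasCRRep ρ f 0 := by
  obtain ⟨α, β, γ, δ, hdet, h⟩ := hf
  have hγ : γ = 0 := by
    have := h none
    by_contra hγ
    simp [mobiusFun, hγ] at this
  subst hγ
  have hα : α ≠ 0 := by rintro rfl; simp at hdet
  have hδ : δ ≠ 0 := by rintro rfl; simp at hdet
  refine ⟨fun _ => f, fun _ => ⟨α / δ, β / δ, div_ne_zero hα hδ, fun x => ?_⟩, by simp⟩
  have := h (some x)
  simp only [mobiusFun, optionCongr_apply, Option.map_some, zero_mul, zero_add, hδ, if_false,
    Option.some.injEq] at this
  rw [this]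
  field_simp

/-- The composite of a degree-one rational function with `x ↦ 1 / (x - c)`. -/
theorem mobiusFun_inv_sub (c α β γ δ : F) (hdet : α * δ - β * γ ≠ 0) (y : Option F) :
    mobiusFun 0 1 1 (-c) (mobiusFun α β γ δ y) =
      mobiusFun γ δ (α - c * γ) (β - c * δ) y := by
  cases y with
  | none =>
    by_cases hγ : γ = 0
    · have hα : α ≠ 0 := by rintro rfl; simp [hγ] at hdet
      simp [mobiusFun, hγ, hα]
    · have h : α / γ + -c = (α - c * γ) / γ := by field_simp; ring
      simp [mobiusFun, hγ, h]
  | some x =>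
    have e : (α - c * γ) * x + (β - c * δ) = (α * x + β) - c * (γ * x + δ) := by ring
    by_cases hγ : γ * x + δ = 0
    · have hα : α * x + β ≠ 0 := by
        intro h
        apply hdet
        by_cases hg : γ = 0
        · have hd : δ = 0 := by simpa [hg] using hγ
          simp [hg, hd]
        · apply mul_left_cancel₀ hg
          linear_combination α * γ * hγ - γ * γ * h
      simp [mobiusFun, hγ, e, hα]
    · have h : (α * x + β) / (γ * x + δ) + -c =
          ((α - c * γ) * x + (β - c * δ)) / (γ * x + δ) := by
        rw [e, eq_div_iff hγ, add_mul, div_mul_cancel₀ _ hγ]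
        ring
      simp [mobiusFun, hγ, h]

/-- A permutation of `F` that is a degree-one rational function composed with a star product
of `k` transpositions is a composition of affine maps and `k` inversions. -/
theorem hasCRRep_of_starProd {ρ : Equiv.Perm F} (hρ : ∀ a, ρ a = a⁻¹) (l : List F) :
    ∀ (μ : Equiv.Perm (Option F)) (f : Equiv.Perm F), IsMobius μ →
      f.optionCongr = μ * starProd l → HasCRRep ρ f l.length := by
  induction l using List.reverseRecOn with
  | nil =>
    intro μ f hμ hf
    rw [starProd_nil, mul_one] at hf
    exact hasCRRep_zero_of_isMobius (hf ▸ hμ)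
  | append_singleton l a ih =>
    intro μ f hμ hf
    obtain ⟨α, β, γ, δ, hdet, h⟩ := hμ
    rw [starProd_append, starProd_cons, starProd_nil, mul_one, ← mul_assoc,
      mul_swap_eq_swap_mul] at hf
    have hnone : (μ * starProd l) (some a) = none := by
      have := congrArg (fun e : Equiv.Perm (Option F) => e none) hf
      simpa [swap_apply_left] using this.symm
    obtain ⟨c, hc⟩ : ∃ c, (μ * starProd l) none = some c := by
      refine Option.ne_none_iff_exists'.1 fun h' => ?_
      exact absurd ((μ * starProd l).injective (h'.trans hnone.symm)) (by simp)
    rw [hnone, hc] at hf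
    have hκ : ∀ z, (ρ * Equiv.subRight c).optionCongr (swap (some c) none z) =
        mobiusFun 0 1 1 (-c) z := by
      intro z
      cases z with
      | none => simp [mobiusFun, hρ]
      | some x =>
        by_cases hx : x = c
        · simp [mobiusFun, hx]
        · rw [swap_apply_of_ne_of_ne (by simpa using hx) (by simp)]
          simp [mobiusFun, hρ, ← sub_eq_add_neg, sub_ne_zero.2 hx]
    have hmob : IsMobius ((ρ * Equiv.subRight c).optionCongr * swap (some c) none * μ) := by
      refine ⟨γ, δ, α - c * γ, β - c * δ, ?_, fun y => ?_⟩
      · intro h0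
        apply hdet
        linear_combination -h0
      · rw [mul_apply, mul_apply, hκ, h, mobiusFun_inv_sub _ _ _ _ _ hdet]
    have hrep := ih _ (ρ * Equiv.subRight c * f) hmob (by
      have : (ρ * Equiv.subRight c * f).optionCongr =
          (ρ * Equiv.subRight c).optionCongr * f.optionCongr := by
        ext x : 1
        cases x <;> rfl
      rw [this, hf]
      simp only [mul_assoc])
    have haff : IsAffinePerm (Equiv.addRight c) := ⟨1, c, one_ne_zero, fun x => by simp⟩
    have hfin := hrep.cons haff
    have he : Equiv.addRight c * ρ * (ρ * Equiv.subRight c * f) = f := by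
      ext x
      simp [hρ]
    rw [he] at hfin
    simpa using hfin

end CarlitzRank

/-- if f = μ ∘ σ is a permutation of 𝔽_q (extended to ℙ¹(𝔽_q) fixing ∞),
with μ induced by a degree-one rational function, σ moving exactly s points of 𝔽_q and
having exactly t nontrivial orbits on ℙ¹(𝔽_q), and n := s + t if σ(∞) = ∞ while
n := s + t − 1 otherwise, then the Carlitz rank of f is at most n. -/
theorem carlitzRank_le
    {F : Type*} [Field F] [Fintype F] [DecidableEq F]
    (hq : 2 < Fintype.card F)
    (ρ : Equiv.Perm F) (hρ : ∀ a : F, ρ a = a ^ (Fintype.card F - 2))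
    (μ σ : Equiv.Perm (Option F)) (hμ : IsMobius μ)
    (f : Equiv.Perm F) (hf : f.optionCongr = μ * σ)
    (s t n : ℕ)
    (hs : (Finset.filter (fun x : F => σ (some x) ≠ some x) Finset.univ).card = s)
    (ht : Set.ncard {o : Set (Option F) | ∃ x, σ x ≠ x ∧
            o = Set.range (fun m : ℤ => (σ ^ m) x)} = t)
    (hn : n = if σ none = none then s + t else s + t - 1) :
    sInf {m : ℕ | HasCRRep ρ f m} ≤ n := by
  have hinv : ∀ a : F, ρ a = a⁻¹ := by
    intro a
    rw [hρ]
    rcases eq_or_ne a 0 with rfl | ha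
    · rw [inv_zero, zero_pow (by omega)]
    · refine eq_inv_of_mul_eq_one_left ?_
      rw [← pow_succ, ← FiniteField.pow_card_sub_one_eq_one a ha]
      congr 1
      omega
  obtain ⟨l, hl, hlen⟩ := exists_starProd σ
  have hrep := hasCRRep_of_starProd hinv l μ f hμ (hl ▸ hf)
  refine (Nat.sInf_le hrep).trans ?_
  have hcard := card_support_option σ
  have hcyc := card_cycleFactorsFinset_le σ
  rw [ht] at hcyc
  rw [hs] at hcard
  split_ifs at * <;> omega
end

section
/- Let q > 2 be a prime power and let f be a nontrivial permutation of 𝔽_q that moves exactly s points of 𝔽_q and has exactly t nontrivial orbits. Then f can be written as a composition f = θ₀ ∘ ρ ∘ θ₁ ∘ ρ ∘ ⋯ ∘ ρ ∘ θ_k with k = s + t, where ρ : 𝔽_q → 𝔽_q is a ↦ a^{q−2} and each θ_i is a permutation of 𝔽_q induced by a degree-one polynomial over 𝔽_q; in particular the Carlitz rank of f is at most s + t. Moreover, if q ≥ 2s + t + 2, then the Carlitz rank of f is exactly s + t. -/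
open Equiv OnePoint

open scoped MatrixGroups

namespace CarlitzRank

section Star

variable {α : Type*}

/-- The extension of a permutation of `α` to `OnePoint α` fixing `∞`. -/
def extend : Perm α →* Perm (OnePoint α) where
  toFun f := Equiv.optionCongr f
  map_one' := Equiv.optionCongr_one
  map_mul' f g := Equiv.ext fun x => by cases x <;> rfl

@[simp]
theorem extend_coe (f : Perm α) (x : α) : extend f (x : OnePoint α) = (f x : OnePoint α) := rfl

@[simp]
theorem extend_infty (f : Perm α) : extend f ∞ = ∞ := rfl

theorem extend_injective : Function.Injective (extend : Perm α → Perm (OnePoint α)) :=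
  Equiv.optionCongr_injective

variable [DecidableEq α]

instance : DecidableEq (OnePoint α) := inferInstanceAs (DecidableEq (Option α))

/-- The product of the transpositions `(∞ a)` of `OnePoint α`, for `a` running through a list. -/
def starProd (l : List α) : Perm (OnePoint α) :=
  (l.map fun a : α => swap ∞ (a : OnePoint α)).prod

@[simp]
theorem starProd_nil : starProd ([] : List α) = 1 := rfl

@[simp]
theorem starProd_cons (a : α) (l : List α) :
    starProd (a :: l) = swap ∞ (a : OnePoint α) * starProd l := by
  simp [starProd]

@[simp]
theorem starProd_append (l l' : List α) : starProd (l ++ l') = starProd l * starProd l' := by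
  simp [starProd]

theorem starProd_map_mul_extend (h : Perm α) (l : List α) :
    starProd (l.map h) * extend h = extend h * starProd l := by
  induction l with
  | nil => simp
  | cons a l ih =>
    rw [List.map_cons, starProd_cons, starProd_cons, mul_assoc, ih, ← mul_assoc, ← mul_assoc,
      mul_swap_eq_swap_mul, extend_infty, extend_coe]

theorem starProd_apply_of_notMem {l : List α} {x : α} (hx : x ∉ l) :
    starProd l (x : OnePoint α) = x := by
  induction l with
  | nil => rfl
  | cons a l ih =>
    rw [List.mem_cons, not_or] at hx
    rw [starProd_cons, Perm.mul_apply, ih hx.2]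
    exact swap_apply_of_ne_of_ne (coe_ne_infty x) (by simpa using hx.1)

theorem exists_append_of_starProd_apply {l : List α} {x y : α} (hxy : x ≠ y)
    (h : starProd l (x : OnePoint α) = y) :
    ∃ l₁ l₂, l = l₁ ++ y :: l₂ ∧ y ∉ l₁ ∧ x ∈ l₂ := by
  induction l with
  | nil => exact absurd (coe_injective h) hxy
  | cons a l ih =>
    rw [starProd_cons, Perm.mul_apply, ← swap_inv, Perm.inv_eq_iff_eq] at h
    by_cases hay : a = y
    · subst hay
      rw [swap_apply_right] at h
      refine ⟨[], l, rfl, by simp, ?_⟩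
      by_contra hx
      rw [starProd_apply_of_notMem hx] at h
      exact coe_ne_infty x h
    · rw [swap_apply_of_ne_of_ne (coe_ne_infty y) (by simpa using Ne.symm hay)] at h
      obtain ⟨l₁, l₂, rfl, h₁, h₂⟩ := ih h
      exact ⟨a :: l₁, l₂, rfl, by simp [h₁, Ne.symm hay], h₂⟩

theorem mem_of_extend_eq_starProd {f : Perm α} {l : List α} (h : extend f = starProd l) {x : α}
    (hx : f x ≠ x) : x ∈ l := by
  by_contra hl
  have := starProd_apply_of_notMem hl
  rw [← h, extend_coe] at this
  exact hx (coe_injective this)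

/-- Every nontrivial orbit contains a point which occurs at least twice among the transpositions. -/
theorem exists_two_le_count_of_extend_eq_starProd [Fintype α] {f : Perm α} {l : List α}
    (h : extend f = starProd l) {x : α} (hx : f x ≠ x) :
    ∃ y, f.SameCycle x y ∧ 2 ≤ l.count y := by
  by_contra! H
  obtain ⟨y, hy, hmin⟩ := Set.exists_min_image {y | f.SameCycle x y} (fun y => l.idxOf y)
    (Set.toFinite _) ⟨x, Perm.SameCycle.refl f x⟩
  have hfy : y ≠ f y := fun e => hx ((hy.apply_eq_self_iff).2 e.symm)
  obtain ⟨l₁, l₂, hl, h₁, h₂⟩ := exists_append_of_starProd_apply hfy (l := l) (by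
    rw [← h, extend_coe])
  have hle := hmin (f y) (Perm.sameCycle_apply_right.2 hy)
  have hc := H y hy
  have hy₁ : y ∉ l₁ := by
    intro hmem
    have := List.count_pos_iff.2 hmem
    have := List.count_pos_iff.2 h₂
    rw [hl, List.count_append, List.count_cons_of_ne hfy.symm] at hc
    omega
  rw [hl, List.idxOf_append_of_notMem h₁, List.idxOf_append_of_notMem hy₁, List.idxOf_cons_self,
    List.idxOf_cons_ne _ hfy.symm] at hle
  omega

theorem card_support_add_ncard_orbits_le [Fintype α] {f : Perm α} {l : List α}
    (h : extend f = starProd l) :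
    f.support.card + {o : Set α | ∃ x, f x ≠ x ∧
      o = Set.range (fun m : ℤ => (f ^ m) x)}.ncard ≤ l.length := by
  classical
  set D := f.support.filter (fun x => 2 ≤ l.count x) with hD
  have hsub : {o : Set α | ∃ x, f x ≠ x ∧ o = Set.range (fun m : ℤ => (f ^ m) x)} ⊆
      (fun x => Set.range (fun m : ℤ => (f ^ m) x)) '' (D : Set α) := by
    rintro o ⟨x, hx, rfl⟩
    obtain ⟨y, hxy, hy⟩ := exists_two_le_count_of_extend_eq_starProd h hx
    refine ⟨y, ?_, ?_⟩
    · simpa [hD, hy] using fun e => hx (hxy.apply_eq_self_iff.2 e)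
    · ext z
      exact ⟨fun hz => hxy.trans hz, fun hz => hxy.symm.trans hz⟩
  have hcard : _ ≤ D.card := (Set.ncard_le_ncard hsub (Set.toFinite _)).trans
    ((Set.ncard_image_le (Set.toFinite _)).trans (Set.ncard_coe_finset D).le)
  have hsum : ∑ x, l.count x = l.length := by
    simpa using Multiset.sum_count_eq_card (s := Finset.univ) (m := (l : Multiset α))
      (fun a _ => Finset.mem_univ a)
  have : f.support.card + D.card ≤ ∑ x, l.count x := calc
    _ = ∑ x ∈ f.support, (1 + if 2 ≤ l.count x then 1 else 0) := by
      rw [Finset.sum_add_distrib, Finset.sum_boole, Finset.sum_const]; simp [hD]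
    _ ≤ ∑ x ∈ f.support, l.count x := by
      refine Finset.sum_le_sum fun x hx => ?_
      have := List.count_pos_iff.2 (mem_of_extend_eq_starProd h (Perm.mem_support.1 hx))
      split_ifs <;> omega
    _ ≤ _ := Finset.sum_le_sum_of_subset (Finset.subset_univ _)
  omega

theorem extend_formPerm_cons {x : α} {l : List α} (hl : (x :: l).Nodup) :
    extend (x :: l).formPerm = starProd (x :: (l.reverse ++ [x])) := by
  induction l generalizing x with
  | nil => simp
  | cons y l ih =>
    have hxy : x ≠ y := by rintro rfl; simp at hl
    have hx : starProd l.reverse (x : OnePoint α) = x :=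
      starProd_apply_of_notMem (by simp at hl ⊢; tauto)
    have hy : starProd l.reverse (y : OnePoint α) = y :=
      starProd_apply_of_notMem (by simp at hl ⊢; tauto)
    have hext : extend (swap x y) = swap (x : OnePoint α) y := Equiv.optionCongr_swap x y
    have hW : starProd l.reverse * swap (x : OnePoint α) y =
        swap (x : OnePoint α) y * starProd l.reverse := by
      rw [mul_swap_eq_swap_mul, hx, hy]
    have hl' : swap (x : OnePoint α) y * swap ∞ (y : OnePoint α) =
        swap ∞ (x : OnePoint α) * swap (x : OnePoint α) y := by
      rw [mul_swap_eq_swap_mul, swap_apply_right,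
        swap_apply_of_ne_of_ne (infty_ne_coe x) (infty_ne_coe y)]
    have hr : swap (x : OnePoint α) y * swap ∞ (y : OnePoint α) =
        swap ∞ (y : OnePoint α) * swap ∞ (x : OnePoint α) := by
      rw [mul_swap_eq_swap_mul (swap ∞ (y : OnePoint α)), swap_apply_left,
        swap_apply_of_ne_of_ne (coe_ne_infty x) (by simpa using hxy), swap_comm (y : OnePoint α)]
    rw [List.formPerm_cons_cons, map_mul, ih (List.nodup_cons.1 hl).2, hext]
    simp only [starProd_cons, starProd_append, starProd_nil, mul_one, List.reverse_cons, mul_assoc]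
    rw [← mul_assoc, hl', mul_assoc, ← hr, ← mul_assoc (starProd l.reverse), hW]
    simp only [mul_assoc]

theorem exists_extend_eq_starProd [Fintype α] (f : Perm α) :
    ∃ l : List α, l.length = f.support.card + f.cycleType.card ∧ extend f = starProd l := by
  induction f using Perm.cycle_induction_on with
  | base_one => exact ⟨[], by simp⟩
  | base_cycles σ hσ =>
    obtain ⟨x, hx, -⟩ := id hσ
    have hform := Perm.formPerm_toList σ x
    have hlen := Perm.length_toList σ x
    have hnodup := Perm.nodup_toList σ x
    rw [hσ.cycleOf_eq hx] at hform hlen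
    cases hL : σ.toList x with
    | nil => simp [hL] at hform; simp [← hform] at hx
    | cons a l =>
      rw [hL] at hform hlen hnodup
      refine ⟨a :: (l.reverse ++ [a]), ?_, ?_⟩
      · simp [hσ.cycleType, ← hlen]
      · rw [← extend_formPerm_cons hnodup, hform]
  | induction_disjoint σ τ hd _ hσ hτ =>
    obtain ⟨l, hl, hl'⟩ := hσ
    obtain ⟨m, hm, hm'⟩ := hτ
    refine ⟨l ++ m, ?_, by simp [hl', hm']⟩
    rw [hd.cycleType_mul, hd.card_support_mul, List.length_append, Multiset.card_add]
    omega

theorem ncard_orbits_eq_card_cycleType [Fintype α] (f : Perm α) :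
    {o : Set α | ∃ x, f x ≠ x ∧ o = Set.range (fun m : ℤ => (f ^ m) x)}.ncard =
      f.cycleType.card := by
  have himage : {o : Set α | ∃ x, f x ≠ x ∧ o = Set.range (fun m : ℤ => (f ^ m) x)} =
      (fun c : Perm α => (c.support : Set α)) '' (f.cycleFactorsFinset : Set (Perm α)) := by
    have horb : ∀ x, f x ≠ x → Set.range (fun m : ℤ => (f ^ m) x) = (f.cycleOf x).support := by
      intro x hx
      ext y
      rw [Finset.mem_coe, Perm.mem_support_cycleOf_iff' hx]
      rfl
    ext o
    constructor
    · rintro ⟨x, hx, rfl⟩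
      exact ⟨f.cycleOf x, Perm.cycleOf_mem_cycleFactorsFinset_iff.2 (Perm.mem_support.2 hx),
        (horb x hx).symm⟩
    · rintro ⟨c, hc, rfl⟩
      obtain ⟨x, hx⟩ := (Perm.mem_cycleFactorsFinset_iff.1 hc).1.nonempty_support
      have hfx : f x ≠ x := Perm.mem_support.1 (Perm.mem_cycleFactorsFinset_support_le hc hx)
      refine ⟨x, hfx, ?_⟩
      rw [horb x hfx, ← Perm.cycle_is_cycleOf hx hc]
  rw [himage, Set.InjOn.ncard_image, Set.ncard_coe_finset, Perm.cycleType_def, Multiset.card_map,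
    Finset.card_def]
  intro c hc d hd hcd
  obtain ⟨x, hx⟩ := (Perm.mem_cycleFactorsFinset_iff.1 hc).1.nonempty_support
  have hx' : x ∈ d.support := by rwa [← Finset.coe_injective hcd]
  rw [Perm.cycle_is_cycleOf hx hc, Perm.cycle_is_cycleOf hx' hd]

end Star

section Mobius

variable {F : Type*} [Field F]

theorem hasCRRep_zero {ρ f : Perm F} : HasCRRep ρ f 0 ↔ IsAffinePerm f := by
  constructor
  · rintro ⟨θ, hθ, rfl⟩
    simpa using hθ 0
  · exact fun h => ⟨fun _ => f, fun _ => h, by simp⟩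

theorem hasCRRep_succ {ρ f : Perm F} {n : ℕ} :
    HasCRRep ρ f (n + 1) ↔ ∃ g θ : Perm F, HasCRRep ρ g n ∧ IsAffinePerm θ ∧ f = g * (ρ * θ) := by
  constructor
  · rintro ⟨θ, hθ, rfl⟩
    refine ⟨_, θ (Fin.last _), ⟨fun i => θ i.castSucc, fun i => hθ _, rfl⟩, hθ _, ?_⟩
    rw [List.ofFn_succ', List.prod_concat, mul_assoc]
    rfl
  · rintro ⟨g, θ', ⟨θ, hθ, rfl⟩, hθ', rfl⟩
    refine ⟨Fin.snoc θ θ', fun i => ?_, ?_⟩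
    · induction i using Fin.lastCases with
      | last => simpa using hθ'
      | cast i => simpa using hθ i
    · rw [List.ofFn_succ', List.prod_concat, mul_assoc]
      simp only [Fin.succ_castSucc, Fin.succ_last, Fin.snoc_castSucc, Fin.snoc_last]
      simp

variable [DecidableEq F]

theorem IsAffinePerm.exists_extend_eq_toPerm {θ : Perm F} (h : IsAffinePerm θ) :
    ∃ g : GL (Fin 2) F, extend θ = MulAction.toPerm g := by
  obtain ⟨α, β, hα, hθ⟩ := h
  refine ⟨Matrix.GeneralLinearGroup.mkOfDetNeZero !![α, β; 0, 1] (by simpa), Equiv.ext fun x => ?_⟩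
  cases x with
  | infty => simp [smul_infty_eq_ite, Matrix.GeneralLinearGroup.mkOfDetNeZero]
  | coe x => simp [smul_some_eq_ite, Matrix.GeneralLinearGroup.mkOfDetNeZero, hθ]

theorem isAffinePerm_of_extend_eq_toPerm {f : Perm F} {g : GL (Fin 2) F}
    (h : extend f = MulAction.toPerm g) : IsAffinePerm f := by
  have hinf := Equiv.congr_fun h ∞
  rw [extend_infty, MulAction.toPerm_apply, eq_comm, smul_infty_eq_self_iff] at hinf
  have hdet := g.det_ne_zero
  rw [Matrix.det_fin_two, hinf, mul_zero, sub_zero] at hdet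
  have h₁ := right_ne_zero_of_mul hdet
  refine ⟨g 0 0 / g 1 1, g 0 1 / g 1 1, div_ne_zero (left_ne_zero_of_mul hdet) h₁, fun x => ?_⟩
  have hx := Equiv.congr_fun h (x : OnePoint F)
  rw [extend_coe, MulAction.toPerm_apply, smul_some_eq_ite, hinf, zero_mul, zero_add, if_neg h₁,
    coe_eq_coe] at hx
  rw [hx]
  ring

theorem extend_inv_eq_toPerm_mul_swap {ρ : Perm F} (hρ : ∀ a, ρ a = a⁻¹) :
    ∃ g : GL (Fin 2) F, extend ρ = MulAction.toPerm g * swap ∞ ((0 : F) : OnePoint F) := by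
  refine ⟨Matrix.GeneralLinearGroup.mkOfDetNeZero !![0, 1; 1, 0] (by simp), Equiv.ext fun x => ?_⟩
  cases x with
  | infty => simp [smul_some_eq_ite, Matrix.GeneralLinearGroup.mkOfDetNeZero]
  | coe x =>
    by_cases hx : x = 0
    · simp [hx, smul_infty_eq_ite, Matrix.GeneralLinearGroup.mkOfDetNeZero, hρ]
    · rw [Perm.mul_apply, swap_apply_of_ne_of_ne (coe_ne_infty x) (by simpa using hx)]
      simp [smul_some_eq_ite, Matrix.GeneralLinearGroup.mkOfDetNeZero, hρ, hx]

theorem hasCRRep_iff {ρ : Perm F} (hρ : ∀ a, ρ a = a⁻¹) {f : Perm F} {n : ℕ} :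
    HasCRRep ρ f n ↔ ∃ (g : GL (Fin 2) F) (l : List F), l.length = n ∧
      extend f = MulAction.toPerm g * starProd l := by
  obtain ⟨j, hj⟩ := extend_inv_eq_toPerm_mul_swap hρ
  have hmul : ∀ g g' : GL (Fin 2) F, (MulAction.toPerm (g * g') : Perm (OnePoint F)) =
      MulAction.toPerm g * MulAction.toPerm g' := (MulAction.toPermHom _ _).map_mul
  have hinv : ∀ g : GL (Fin 2) F, (MulAction.toPerm g⁻¹ : Perm (OnePoint F)) =
      (MulAction.toPerm g)⁻¹ := (MulAction.toPermHom _ _).map_inv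
  induction n generalizing f with
  | zero =>
    rw [hasCRRep_zero]
    constructor
    · intro h
      obtain ⟨g, hg⟩ := IsAffinePerm.exists_extend_eq_toPerm h
      exact ⟨g, [], rfl, by simpa using hg⟩
    · rintro ⟨g, l, hl, h⟩
      rw [List.length_eq_zero_iff] at hl
      subst hl
      exact isAffinePerm_of_extend_eq_toPerm (g := g) (by simpa using h)
  | succ n ih =>
    rw [hasCRRep_succ]
    constructor
    · rintro ⟨h, θ, hh, hθ, rfl⟩
      obtain ⟨g, l, hl, hgl⟩ := ih.1 hh
      obtain ⟨k, hk⟩ := IsAffinePerm.exists_extend_eq_toPerm hθ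
      refine ⟨g * j * k, θ⁻¹ 0 :: l.map ⇑(ρ * θ)⁻¹, by simp [hl], ?_⟩
      have hT : starProd l * extend (ρ * θ) =
          extend (ρ * θ) * starProd (l.map ⇑(ρ * θ)⁻¹) := by
        rw [← starProd_map_mul_extend, List.map_map, ← Perm.coe_mul, mul_inv_cancel, Perm.coe_one,
          List.map_id]
      have hs : swap ∞ ((0 : F) : OnePoint F) * extend θ =
          extend θ * swap ∞ ((θ⁻¹ 0 : F) : OnePoint F) := by
        rw [mul_swap_eq_swap_mul, extend_infty, extend_coe, ← Perm.mul_apply, mul_inv_cancel,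
          Perm.one_apply]
      rw [map_mul, hgl, mul_assoc, hT, map_mul, hj, mul_assoc _ _ (extend θ), hs, hk, hmul, hmul,
        starProd_cons]
      simp only [mul_assoc]
    · rintro ⟨g, l, hl, hgl⟩
      obtain ⟨c, l, rfl⟩ := List.exists_cons_of_length_eq_add_one hl
      have hθ : IsAffinePerm (Equiv.addRight (-c)) := ⟨1, -c, one_ne_zero, fun x => by simp⟩
      set θ : Perm F := Equiv.addRight (-c)
      have hθc : θ c = 0 := by simp [θ]
      obtain ⟨k, hk⟩ := IsAffinePerm.exists_extend_eq_toPerm hθ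
      refine ⟨f * (ρ * θ)⁻¹, θ, ih.2 ⟨g * k⁻¹ * j⁻¹, l.map ⇑(ρ * θ), by simpa using hl, ?_⟩, hθ,
        (inv_mul_cancel_right _ _).symm⟩
      have hs : extend θ * swap ∞ (c : OnePoint F) =
          swap ∞ ((0 : F) : OnePoint F) * extend θ := by
        rw [mul_swap_eq_swap_mul, extend_infty, extend_coe, hθc]
      have hs' : swap ∞ (c : OnePoint F) = (extend θ)⁻¹ * (MulAction.toPerm j)⁻¹ *
          extend (ρ * θ) := by
        rw [map_mul, hj, mul_assoc _ _ (extend θ), ← hs]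
        group
      rw [map_mul, map_inv, mul_inv_eq_iff_eq_mul, hgl, mul_assoc _ _ (extend (ρ * θ)),
        starProd_map_mul_extend, starProd_cons, hs', hmul, hmul, hinv, hinv, hk]
      simp only [mul_assoc]

theorem toPerm_eq_one_of_two_lt_card {g : GL (Fin 2) F} {S : Finset F} (hS : 2 < S.card)
    (h : ∀ x ∈ S, g • (x : OnePoint F) = x) :
    (MulAction.toPerm g : Perm (OnePoint F)) = 1 := by
  have hroot : ∀ x ∈ S, g 1 0 * x ^ 2 + (g 1 1 - g 0 0) * x - g 0 1 = 0 := fun x hx => by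
    simpa [Matrix.GeneralLinearGroup.fixpointPolynomial] using
      Matrix.GeneralLinearGroup.fixpointPolynomial_aeval_eq_zero_iff.2 (h x hx)
  obtain ⟨x, hx, y, hy, z, hz, hxy, hxz, hyz⟩ := Finset.two_lt_card.1 hS
  have ex := hroot x hx
  have ey := hroot y hy
  have ez := hroot z hz
  have exy : g 1 0 * (x + y) + (g 1 1 - g 0 0) = 0 :=
    mul_left_cancel₀ (sub_ne_zero.2 hxy) (by linear_combination ex - ey)
  have exz : g 1 0 * (x + z) + (g 1 1 - g 0 0) = 0 :=
    mul_left_cancel₀ (sub_ne_zero.2 hxz) (by linear_combination ex - ez)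
  have h₁₀ : g 1 0 = 0 :=
    mul_left_cancel₀ (sub_ne_zero.2 hyz) (by linear_combination exy - exz)
  have h₁₁ : g 1 1 = g 0 0 := by linear_combination exy - (x + y) * h₁₀
  have h₀₁ : g 0 1 = 0 := by linear_combination -ex + x ^ 2 * h₁₀ + x * h₁₁
  have h₀₀ : g 0 0 ≠ 0 := fun h₀ => g.det_ne_zero (by rw [Matrix.det_fin_two]; simp [h₀, h₁₀])
  refine Equiv.ext fun x => ?_
  cases x with
  | infty => simpa [smul_infty_eq_self_iff] using h₁₀
  | coe x => simp [smul_some_eq_ite, h₁₀, h₁₁, h₀₁, h₀₀]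

end Mobius

theorem card_support_add_ncard_orbits_le_of_hasCRRep {F : Type*} [Field F] [Fintype F]
    [DecidableEq F] {ρ : Perm F} (hρ : ∀ a, ρ a = a⁻¹) {f : Perm F} {n : ℕ}
    (hcard : f.support.card + n + 2 < Fintype.card F) (h : HasCRRep ρ f n) :
    f.support.card + {o : Set F | ∃ x, f x ≠ x ∧
      o = Set.range (fun m : ℤ => (f ^ m) x)}.ncard ≤ n := by
  obtain ⟨g, l, rfl, hgl⟩ := (hasCRRep_iff hρ).1 h
  have hS : 2 < (f.support ∪ l.toFinset)ᶜ.card := by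
    have := Finset.card_union_le f.support l.toFinset
    have := l.toFinset_card_le
    rw [Finset.card_compl]
    omega
  have hg := toPerm_eq_one_of_two_lt_card (g := g) hS fun x hx => by
    simp only [Finset.mem_compl, Finset.mem_union, Perm.mem_support, List.mem_toFinset, not_or,
      not_not] at hx
    have := Equiv.congr_fun hgl (x : OnePoint F)
    rw [Perm.mul_apply, starProd_apply_of_notMem hx.2, extend_coe, hx.1] at this
    exact this.symm
  rw [hg, one_mul] at hgl
  exact card_support_add_ncard_orbits_le hgl

end CarlitzRank

/-- a nontrivial permutation f of 𝔽_q moving exactly s points and having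
exactly t nontrivial orbits can be written as f = θ₀ ∘ ρ ∘ θ₁ ∘ ⋯ ∘ ρ ∘ θ_k with
k = s + t and each θᵢ induced by a degree-one polynomial; in particular the Carlitz rank
of f is at most s + t, and it is exactly s + t whenever q ≥ 2s + t + 2. -/
theorem carlitzRank_le_s_add_t
    {F : Type*} [Field F] [Fintype F] [DecidableEq F]
    (hq : 2 < Fintype.card F)
    (ρ : Equiv.Perm F) (hρ : ∀ a : F, ρ a = a ^ (Fintype.card F - 2))
    (f : Equiv.Perm F) (hf : f ≠ 1)
    (s t : ℕ)
    (hs : (Finset.filter (fun x : F => f x ≠ x) Finset.univ).card = s)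
    (ht : Set.ncard {o : Set F | ∃ x, f x ≠ x ∧
            o = Set.range (fun m : ℤ => (f ^ m) x)} = t) :
    HasCRRep ρ f (s + t) ∧
      sInf {n : ℕ | HasCRRep ρ f n} ≤ s + t ∧
      (2 * s + t + 2 ≤ Fintype.card F → sInf {n : ℕ | HasCRRep ρ f n} = s + t) := by
  have hρ' : ∀ a, ρ a = a⁻¹ := fun a => by
    rw [hρ]
    by_cases ha : a = 0
    · rw [ha, inv_zero, zero_pow (by omega)]
    · refine eq_inv_of_mul_eq_one_left ?_
      rw [← pow_succ, show Fintype.card F - 2 + 1 = Fintype.card F - 1 by omega,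
        FiniteField.pow_card_sub_one_eq_one a ha]
  change f.support.card = s at hs
  have hrep : HasCRRep ρ f (s + t) := by
    obtain ⟨l, hl, hfl⟩ := CarlitzRank.exists_extend_eq_starProd f
    rw [← CarlitzRank.ncard_orbits_eq_card_cycleType, hs, ht] at hl
    exact (CarlitzRank.hasCRRep_iff hρ').2 ⟨1, l, hl, by
      rw [hfl, MulAction.toPerm_one, one_mul]⟩
  refine ⟨hrep, Nat.sInf_le hrep, fun hcard => (Nat.sInf_le hrep).antisymm ?_⟩
  by_contra! hlt
  have hmem : HasCRRep ρ f (sInf {n : ℕ | HasCRRep ρ f n}) :=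
    Nat.sInf_mem (s := {n : ℕ | HasCRRep ρ f n}) ⟨_, hrep⟩
  have := CarlitzRank.card_support_add_ncard_orbits_le_of_hasCRRep hρ' (by omega) hmem
  omega
end
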